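/- arXiv:1303.5110 — 10 statements merged into one kernel-verified Lean document; each statement's English description precedes it below -/
import Mathlib

section
/- The 4×4 matrix ρ(c1,c2,c3) is positive semidefinite if and only if the four inequalities 1−c1−c2−c3 ≥ 0, 1−c1+c2+c3 ≥ 0, 1+c1−c2+c3 ≥ 0, and 1+c1+c2−c3 ≥ 0 hold, i.e., if and only if (c1,c2,c3) lies in the tetrahedron with vertices (1,1,−1), (−1,−1,−1), (1,−1,1), and (−1,1,1). -/
open Matrix Kronecker ComplexOrder

/-- Pauli matrices. -/
noncomputable def σx : Matrix (Fin 2) (Fin 2) ℂ := !![0, 1; 1, 0]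
noncomputable def σy : Matrix (Fin 2) (Fin 2) ℂ := !![0, -Complex.I; Complex.I, 0]
noncomputable def σz : Matrix (Fin 2) (Fin 2) ℂ := !![1, 0; 0, -1]

/-- The Bell-diagonal two-qubit state with correlation vector `(c₁, c₂, c₃)`. -/
noncomputable def ρBell (c₁ c₂ c₃ : ℝ) : Matrix (Fin 2 × Fin 2) (Fin 2 × Fin 2) ℂ :=
  (1 / 4 : ℂ) • ((1 : Matrix (Fin 2) (Fin 2) ℂ) ⊗ₖ (1 : Matrix (Fin 2) (Fin 2) ℂ)
    + (c₁ : ℂ) • (σx ⊗ₖ σx) + (c₂ : ℂ) • (σy ⊗ₖ σy) + (c₃ : ℂ) • (σz ⊗ₖ σz))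

/-- The matrix whose columns are the unnormalized Bell vectors: the column `(a, b)` is
`|0, a⟩ + (-1)ᵇ |1, 1 - a⟩`. -/
def bellBasis : Matrix (Fin 2 × Fin 2) (Fin 2 × Fin 2) ℂ :=
  .of fun i k ↦ if i.1 + i.2 = k.1 then (-1) ^ (i.1 * k.2 : ℕ) else 0

/-- The eigenvalue of `ρBell c₁ c₂ c₃` on the Bell vector with index `k`. -/
noncomputable def bellEigenvalue (c₁ c₂ c₃ : ℝ) (k : Fin 2 × Fin 2) : ℝ :=
  (1 + (-1) ^ (k.1 : ℕ) * c₃ + (-1) ^ (k.2 : ℕ) * (c₁ - (-1) ^ (k.1 : ℕ) * c₂)) / 4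

theorem bellBasis_mul_star_self : bellBasis * star bellBasis = (2 : ℂ) • 1 := by
  ext ⟨i, j⟩ ⟨k, l⟩
  fin_cases i <;> fin_cases j <;> fin_cases k <;> fin_cases l <;>
    simp [bellBasis, mul_apply, Fintype.sum_prod_type, star_apply, one_apply, one_add_one_eq_two]

theorem isUnit_bellBasis : IsUnit bellBasis :=
  IsUnit.of_mul_eq_one ((1 / 2 : ℂ) • star bellBasis) <| by
    simp [bellBasis_mul_star_self]

theorem ρBell_eq_conj_diagonal (c₁ c₂ c₃ : ℝ) :
    ρBell c₁ c₂ c₃ =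
      bellBasis * diagonal (fun k ↦ ((bellEigenvalue c₁ c₂ c₃ k / 2 : ℝ) : ℂ)) *
        star bellBasis := by
  ext ⟨i, j⟩ ⟨k, l⟩
  fin_cases i <;> fin_cases j <;> fin_cases k <;> fin_cases l <;>
    simp [ρBell, σx, σy, σz, bellBasis, bellEigenvalue, mul_apply,
      Fintype.sum_prod_type, star_apply, one_apply] <;> ring

/-- `ρ(c₁,c₂,c₃)` is positive semidefinite iff `(c₁,c₂,c₃)` lies in the tetrahedron with
vertices `(1,1,−1)`, `(−1,−1,−1)`, `(1,−1,1)` and `(−1,1,1)`. -/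
theorem ρBell_posSemidef_iff (c₁ c₂ c₃ : ℝ) :
    (ρBell c₁ c₂ c₃).PosSemidef ↔
      0 ≤ 1 - c₁ - c₂ - c₃ ∧ 0 ≤ 1 - c₁ + c₂ + c₃ ∧
      0 ≤ 1 + c₁ - c₂ + c₃ ∧ 0 ≤ 1 + c₁ + c₂ - c₃ := by
  rw [ρBell_eq_conj_diagonal, isUnit_bellBasis.posSemidef_star_right_conjugate_iff,
    posSemidef_diagonal_iff]
  simp only [Complex.zero_le_real, Prod.forall, Fin.forall_fin_two, bellEigenvalue,
    Fin.val_zero, Fin.val_one, pow_zero, pow_one]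
  constructor
  · rintro ⟨⟨h₁, h₂⟩, h₃, h₄⟩
    refine ⟨?_, ?_, ?_, ?_⟩ <;> linarith
  · rintro ⟨h₁, h₂, h₃, h₄⟩
    refine ⟨⟨?_, ?_⟩, ?_, ?_⟩ <;> linarith
end

section
/- For the generalized amplitude damping channel at p = 1/2, with the four Kraus operators E0 = √(1/2)·diag(1, √(1−γ)), E1 = √(1/2)·(the 2×2 matrix with (1,2)-entry √γ and zeros elsewhere), E2 = √(1/2)·diag(√(1−γ), 1), E3 = √(1/2)·(the 2×2 matrix with (2,1)-entry √γ and zeros elsewhere), acting locally on both qubits, the map ε(X) = Σ_{i,j∈{0,1,2,3}} (E_i ⊗ E_j) X (E_i ⊗ E_j)† satisfies ε(ρ(c1,c2,c3)) = ρ(c1(1−γ), c2(1−γ), c3(1−γ)²) for every (c1,c2,c3) ∈ ℝ³ and every γ ∈ [0,1]. -/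
open Matrix Kronecker

/-- The local channel `ε(X) = Σ_{i,j} (E_i ⊗ E_j) X (E_i ⊗ E_j)†` built from single-qubit
Kraus operators acting on both qubits. -/
noncomputable def localChannel {k : ℕ} (E : Fin k → Matrix (Fin 2) (Fin 2) ℂ)
    (X : Matrix (Fin 2 × Fin 2) (Fin 2 × Fin 2) ℂ) :
    Matrix (Fin 2 × Fin 2) (Fin 2 × Fin 2) ℂ :=
  ∑ i, ∑ j, (E i ⊗ₖ E j) * X * (E i ⊗ₖ E j)ᴴ

/-- Kraus operators of the generalized amplitude damping channel at `p = 1/2`. -/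
noncomputable def krausGAD (γ : ℝ) : Fin 4 → Matrix (Fin 2) (Fin 2) ℂ
  | 0 => (Real.sqrt (1 / 2) : ℂ) • !![1, 0; 0, (Real.sqrt (1 - γ) : ℂ)]
  | 1 => (Real.sqrt (1 / 2) : ℂ) • !![0, (Real.sqrt γ : ℂ); 0, 0]
  | 2 => (Real.sqrt (1 / 2) : ℂ) • !![(Real.sqrt (1 - γ) : ℂ), 0; 0, 1]
  | 3 => (Real.sqrt (1 / 2) : ℂ) • !![0, 0; (Real.sqrt γ : ℂ), 0]

/-- The single-qubit channel with Kraus operators `E`. -/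
noncomputable def krausMap {k : ℕ} (E : Fin k → Matrix (Fin 2) (Fin 2) ℂ)
    (A : Matrix (Fin 2) (Fin 2) ℂ) : Matrix (Fin 2) (Fin 2) ℂ :=
  ∑ i, E i * A * (E i)ᴴ

theorem localChannel_add {k : ℕ} (E : Fin k → Matrix (Fin 2) (Fin 2) ℂ)
    (X Y : Matrix (Fin 2 × Fin 2) (Fin 2 × Fin 2) ℂ) :
    localChannel E (X + Y) = localChannel E X + localChannel E Y := by
  simp [localChannel, Matrix.mul_add, Matrix.add_mul, Finset.sum_add_distrib]

theorem localChannel_smul {k : ℕ} (E : Fin k → Matrix (Fin 2) (Fin 2) ℂ) (a : ℂ)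
    (X : Matrix (Fin 2 × Fin 2) (Fin 2 × Fin 2) ℂ) :
    localChannel E (a • X) = a • localChannel E X := by
  simp [localChannel, Finset.smul_sum]

theorem localChannel_kronecker {k : ℕ} (E : Fin k → Matrix (Fin 2) (Fin 2) ℂ)
    (A B : Matrix (Fin 2) (Fin 2) ℂ) :
    localChannel E (A ⊗ₖ B) = krausMap E A ⊗ₖ krausMap E B := by
  simp only [localChannel, conjTranspose_kronecker, ← mul_kronecker_mul]
  ext ⟨a, b⟩ ⟨c, d⟩
  simp only [krausMap, Matrix.sum_apply, kroneckerMap_apply, Finset.sum_mul_sum]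

theorem krausMap_krausGAD (γ : ℝ) (hγ0 : 0 ≤ γ) (hγ1 : γ ≤ 1) (a b c d : ℂ) :
    krausMap (krausGAD γ) !![a, b; c, d]
      = !![(1 - γ / 2) * a + γ / 2 * d, (Real.sqrt (1 - γ) : ℂ) * b;
          (Real.sqrt (1 - γ) : ℂ) * c, γ / 2 * a + (1 - γ / 2) * d] := by
  have hh : (Real.sqrt (1 / 2) : ℂ) ^ 2 = 1 / 2 := by
    rw [← Complex.ofReal_pow, Real.sq_sqrt (by norm_num)]; norm_num
  have hg : (Real.sqrt γ : ℂ) ^ 2 = γ := by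
    rw [← Complex.ofReal_pow, Real.sq_sqrt hγ0]
  have hs : (Real.sqrt (1 - γ) : ℂ) ^ 2 = 1 - γ := by
    rw [← Complex.ofReal_pow, Real.sq_sqrt (by linarith)]; norm_num
  simp only [krausMap, Fin.sum_univ_four, krausGAD]
  generalize Real.sqrt (1 / 2) = h at *
  generalize Real.sqrt γ = g at *
  generalize Real.sqrt (1 - γ) = s at *
  ext i j
  fin_cases i <;> fin_cases j <;>
    simp [Matrix.vecMul, dotProduct, Fin.sum_univ_two] <;> grind

/-- Under the local generalized amplitude damping channel at `p = 1/2`,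
`ρ(c₁,c₂,c₃) ↦ ρ(c₁(1−γ), c₂(1−γ), c₃(1−γ)²)`. -/
theorem gad_ρBell (c₁ c₂ c₃ γ : ℝ) (hγ0 : 0 ≤ γ) (hγ1 : γ ≤ 1) :
    localChannel (krausGAD γ) (ρBell c₁ c₂ c₃)
      = ρBell (c₁ * (1 - γ)) (c₂ * (1 - γ)) (c₃ * (1 - γ) ^ 2) := by
  have hs : (Real.sqrt (1 - γ) : ℂ) * (Real.sqrt (1 - γ) : ℂ) = ((1 - γ : ℝ) : ℂ) := by
    rw [← Complex.ofReal_mul, Real.mul_self_sqrt (by linarith)]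
  have h1 : krausMap (krausGAD γ) 1 = 1 := by
    rw [Matrix.one_fin_two, krausMap_krausGAD γ hγ0 hγ1]
    simp
  have hx : krausMap (krausGAD γ) σx = (Real.sqrt (1 - γ) : ℂ) • σx := by
    rw [σx, krausMap_krausGAD γ hγ0 hγ1]
    simp
  have hy : krausMap (krausGAD γ) σy = (Real.sqrt (1 - γ) : ℂ) • σy := by
    rw [σy, krausMap_krausGAD γ hγ0 hγ1]
    simp
  have hz : krausMap (krausGAD γ) σz = ((1 - γ : ℝ) : ℂ) • σz := by
    rw [σz, krausMap_krausGAD γ hγ0 hγ1]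
    ext i j
    fin_cases i <;> fin_cases j <;> simp <;> ring
  simp only [ρBell, localChannel_add, localChannel_smul, localChannel_kronecker, h1, hx, hy, hz,
    smul_kronecker, kronecker_smul, smul_smul, hs, Complex.ofReal_mul, sq]
end

section
/- Let c1,c2,c3 ∈ ℝ satisfy 0 < |c3| < |c1|, 0 < |c3| < |c2|, and |c1| ≠ |c2|, and define f(p) = mid(|c1|(1−p)², |c2|(1−p)², |c3|) for p ∈ [0,1] (the 1-norm geometric discord of a Bell-diagonal state with correlation vector (c1,c2,c3) evolved under the phase-flip channel). Set p1 = 1 − √(|c3|/min(|c1|,|c2|)) and p2 = 1 − √(|c3|/max(|c1|,|c2|)). Then 0 < p1 < p2 < 1, and f(p) = min(|c1|,|c2|)·(1−p)² for p ∈ [0,p1], f(p) = |c3| for p ∈ [p1,p2] (freezing behavior), and f(p) = max(|c1|,|c2|)·(1−p)² for p ∈ [p2,1] (double sudden change). -/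
/-- The intermediate (median) value of three reals. -/
noncomputable def mid (a b c : ℝ) : ℝ := a + b + c - max a (max b c) - min a (min b c)

theorem mid_comm_left (a b c : ℝ) : mid a b c = mid b a c := by
  unfold mid
  rw [max_left_comm, min_left_comm]
  ring

theorem mid_eq_of_le_of_le {a b c : ℝ} (hab : a ≤ b) (hbc : b ≤ c) : mid a b c = b := by
  unfold mid
  rw [max_eq_right hbc, max_eq_right (hab.trans hbc), min_eq_left hbc, min_eq_left hab]
  ring

theorem mid_eq_right {a b c : ℝ} (hac : a ≤ c) (hcb : c ≤ b) : mid a b c = c := by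
  unfold mid
  rw [max_eq_left hcb, max_eq_right (hac.trans hcb), min_eq_right hcb, min_eq_left hac]
  ring

theorem mid_eq_left {a b c : ℝ} (hca : c ≤ a) (hab : a ≤ b) : mid a b c = a := by
  unfold mid
  rw [max_eq_left (hca.trans hab), max_eq_right hab, min_eq_right (hca.trans hab),
    min_eq_right hca]
  ring

theorem mid_min_max (a b c : ℝ) : mid (min a b) (max a b) c = mid a b c := by
  rcases le_total a b with h | h
  · rw [min_eq_left h, max_eq_right h]
  · rw [min_eq_right h, max_eq_left h, mid_comm_left]

theorem sqrt_div_le_iff {m c q : ℝ} (hm : 0 < m) (hq : 0 ≤ q) :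
    Real.sqrt (c / m) ≤ q ↔ c ≤ m * q ^ 2 := by
  rw [Real.sqrt_le_left hq, div_le_iff₀' hm]

theorem le_sqrt_div_iff {m c q : ℝ} (hm : 0 < m) (hc : 0 ≤ c) (hq : 0 ≤ q) :
    q ≤ Real.sqrt (c / m) ↔ m * q ^ 2 ≤ c := by
  rw [Real.le_sqrt hq (div_nonneg hc hm.le), le_div_iff₀' hm]

/-- Double sudden change with intermediate freezing of the 1-norm geometric discord of a
Bell-diagonal state under the phase-flip channel. -/
theorem phaseFlip_doubleSuddenChange_freezing (c₁ c₂ c₃ : ℝ)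
    (h₁ : 0 < |c₃|) (h₂ : |c₃| < |c₁|) (h₃ : |c₃| < |c₂|) (h₄ : |c₁| ≠ |c₂|)
    (f : ℝ → ℝ) (hf : ∀ p, f p = mid (|c₁| * (1 - p) ^ 2) (|c₂| * (1 - p) ^ 2) |c₃|)
    (p₁ p₂ : ℝ) (hp₁ : p₁ = 1 - Real.sqrt (|c₃| / min |c₁| |c₂|))
    (hp₂ : p₂ = 1 - Real.sqrt (|c₃| / max |c₁| |c₂|)) :
    0 < p₁ ∧ p₁ < p₂ ∧ p₂ < 1 ∧
    (∀ p ∈ Set.Icc (0 : ℝ) p₁, f p = min |c₁| |c₂| * (1 - p) ^ 2) ∧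
    (∀ p ∈ Set.Icc p₁ p₂, f p = |c₃|) ∧
    (∀ p ∈ Set.Icc p₂ (1 : ℝ), f p = max |c₁| |c₂| * (1 - p) ^ 2) := by
  have hf' : ∀ p, f p = mid (min |c₁| |c₂| * (1 - p) ^ 2) (max |c₁| |c₂| * (1 - p) ^ 2) |c₃| := by
    intro p
    rw [hf, min_mul_of_nonneg _ _ (sq_nonneg _), max_mul_of_nonneg _ _ (sq_nonneg _), mid_min_max]
  have hcm : |c₃| < min |c₁| |c₂| := lt_min h₂ h₃
  have hmM : min |c₁| |c₂| < max |c₁| |c₂| := min_lt_max.2 h₄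
  generalize min |c₁| |c₂| = m at *
  generalize max |c₁| |c₂| = M at *
  have hm : 0 < m := h₁.trans hcm
  have hM : 0 < M := hm.trans hmM
  have hs₁ : Real.sqrt (|c₃| / m) < 1 := by
    rw [Real.sqrt_lt' one_pos, one_pow, div_lt_one hm]
    exact hcm
  have hs₂ : Real.sqrt (|c₃| / M) < Real.sqrt (|c₃| / m) :=
    Real.sqrt_lt_sqrt (by positivity) (div_lt_div_of_pos_left h₁ hm hmM)
  have hs₃ : 0 < Real.sqrt (|c₃| / M) := Real.sqrt_pos.2 (by positivity)
  have hle : ∀ p, m * (1 - p) ^ 2 ≤ M * (1 - p) ^ 2 := fun p =>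
    mul_le_mul_of_nonneg_right hmM.le (sq_nonneg _)
  refine ⟨by linarith, by linarith, by linarith, ?_, ?_, ?_⟩
  · rintro p ⟨-, hp⟩
    rw [hf']
    exact mid_eq_left ((sqrt_div_le_iff hm (by linarith)).1 (by linarith)) (hle p)
  · rintro p ⟨hp, hp'⟩
    rw [hf']
    exact mid_eq_right ((le_sqrt_div_iff hm h₁.le (by linarith)).1 (by linarith))
      ((sqrt_div_le_iff hM (by linarith)).1 (by linarith))
  · rintro p ⟨hp, hp'⟩
    rw [hf']
    exact mid_eq_of_le_of_le (hle p) ((le_sqrt_div_iff hM h₁.le (by linarith)).1 (by linarith))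
end

section
/- Let c1,c2,c3 ∈ ℝ satisfy 0 < |c1| < |c2|, 0 < |c1| < |c3|, and |c2| ≠ |c3|, and define f(p) = mid(|c1|, |c2|(1−p)², |c3|(1−p)²) for p ∈ [0,1] (the 1-norm geometric discord of a Bell-diagonal state with correlation vector (c1,c2,c3) evolved under the bit-flip channel). Set p1 = 1 − √(|c1|/min(|c2|,|c3|)) and p2 = 1 − √(|c1|/max(|c2|,|c3|)). Then 0 < p1 < p2 < 1, and f(p) = min(|c2|,|c3|)·(1−p)² for p ∈ [0,p1], f(p) = |c1| for p ∈ [p1,p2] (freezing behavior), and f(p) = max(|c2|,|c3|)·(1−p)² for p ∈ [p2,1] (double sudden change). -/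
theorem mid_eq_min {a x y : ℝ} (h : a ≤ min x y) : mid a x y = min x y := by
  have hM : a ≤ max x y := h.trans min_le_max
  rw [mid, max_eq_right hM, min_eq_left h]
  linarith [min_add_max x y]

theorem mid_eq_left_s7 {a x y : ℝ} (hm : min x y ≤ a) (hM : a ≤ max x y) : mid a x y = a := by
  rw [mid, max_eq_right hM, min_eq_right hm]
  linarith [min_add_max x y]

theorem mid_eq_max {a x y : ℝ} (h : max x y ≤ a) : mid a x y = max x y := by
  have hm : min x y ≤ a := min_le_max.trans h
  rw [mid, max_eq_left h, min_eq_right hm]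
  linarith [min_add_max x y]

theorem le_one_sub_sqrt_div_iff {a k p : ℝ} (hk : 0 < k) (hp : p ≤ 1) :
    p ≤ 1 - √(a / k) ↔ a ≤ k * (1 - p) ^ 2 := by
  rw [le_sub_comm, Real.sqrt_le_left (sub_nonneg.2 hp), div_le_iff₀' hk]

theorem one_sub_sqrt_div_le_iff {a k p : ℝ} (ha : 0 ≤ a) (hk : 0 < k) (hp : p ≤ 1) :
    1 - √(a / k) ≤ p ↔ k * (1 - p) ^ 2 ≤ a := by
  rw [sub_le_comm, Real.le_sqrt (sub_nonneg.2 hp) (div_nonneg ha hk.le), le_div_iff₀' hk]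

/-- Double sudden change with intermediate freezing of the 1-norm geometric discord of a
Bell-diagonal state under the bit-flip channel. -/
theorem bitFlip_doubleSuddenChange_freezing (c₁ c₂ c₃ : ℝ)
    (h₁ : 0 < |c₁|) (h₂ : |c₁| < |c₂|) (h₃ : |c₁| < |c₃|) (h₄ : |c₂| ≠ |c₃|)
    (f : ℝ → ℝ) (hf : ∀ p, f p = mid |c₁| (|c₂| * (1 - p) ^ 2) (|c₃| * (1 - p) ^ 2))
    (p₁ p₂ : ℝ) (hp₁ : p₁ = 1 - Real.sqrt (|c₁| / min |c₂| |c₃|))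
    (hp₂ : p₂ = 1 - Real.sqrt (|c₁| / max |c₂| |c₃|)) :
    0 < p₁ ∧ p₁ < p₂ ∧ p₂ < 1 ∧
    (∀ p ∈ Set.Icc (0 : ℝ) p₁, f p = min |c₂| |c₃| * (1 - p) ^ 2) ∧
    (∀ p ∈ Set.Icc p₁ p₂, f p = |c₁|) ∧
    (∀ p ∈ Set.Icc p₂ (1 : ℝ), f p = max |c₂| |c₃| * (1 - p) ^ 2) := by
  have hm : |c₁| < min |c₂| |c₃| := lt_min h₂ h₃
  have hmM : min |c₂| |c₃| < max |c₂| |c₃| := min_lt_max.2 h₄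
  have hm0 : 0 < min |c₂| |c₃| := h₁.trans hm
  have hM0 : 0 < max |c₂| |c₃| := hm0.trans hmM
  have hp₁_pos : 0 < p₁ := by
    rw [hp₁, sub_pos, Real.sqrt_lt' one_pos, one_pow, div_lt_one hm0]
    exact hm
  have hp₁₂ : p₁ < p₂ := by
    rw [hp₁, hp₂]
    exact sub_lt_sub_left (Real.sqrt_lt_sqrt (div_pos h₁ hM0).le
      (div_lt_div_of_pos_left h₁ hm0 hmM)) 1
  have hp₂_lt : p₂ < 1 := by
    rw [hp₂]
    exact sub_lt_self 1 (Real.sqrt_pos.2 (div_pos h₁ hM0))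
  have hmin (p : ℝ) : min |c₂| |c₃| * (1 - p) ^ 2
      = min (|c₂| * (1 - p) ^ 2) (|c₃| * (1 - p) ^ 2) := min_mul_of_nonneg _ _ (sq_nonneg _)
  have hmax (p : ℝ) : max |c₂| |c₃| * (1 - p) ^ 2
      = max (|c₂| * (1 - p) ^ 2) (|c₃| * (1 - p) ^ 2) := max_mul_of_nonneg _ _ (sq_nonneg _)
  refine ⟨hp₁_pos, hp₁₂, hp₂_lt, fun p hp => ?_, fun p hp => ?_, fun p hp => ?_⟩
  · have hp1 : p ≤ 1 := hp.2.trans (hp₁₂.trans hp₂_lt).le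
    rw [hf, hmin]
    exact mid_eq_min (hmin p ▸ (le_one_sub_sqrt_div_iff hm0 hp1).1 (hp₁ ▸ hp.2))
  · have hp1 : p ≤ 1 := hp.2.trans hp₂_lt.le
    rw [hf]
    exact mid_eq_left_s7 (hmin p ▸ (one_sub_sqrt_div_le_iff h₁.le hm0 hp1).1 (hp₁ ▸ hp.1))
      (hmax p ▸ (le_one_sub_sqrt_div_iff hM0 hp1).1 (hp₂ ▸ hp.2))
  · rw [hf, hmax]
    exact mid_eq_max (hmax p ▸ (one_sub_sqrt_div_le_iff h₁.le hM0 hp.2).1 (hp₂ ▸ hp.1))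
end

section
/- Let c1,c2,c3 ∈ ℝ and define f(p) = mid(|c1|, |c2|(1−p)², |c3|(1−p)²) for p ∈ [0,1]. Then the set {p ∈ (0,1) : f is not differentiable at p} has exactly two elements if and only if c1 ≠ 0, |c1| < |c2|, |c1| < |c3|, and |c2| ≠ |c3| (necessary and sufficient conditions for a double sudden change under the bit-flip channel). -/
open Filter Topology

theorem mid_eq_max_min (a b c : ℝ) : mid a b c = max (min b c) (min a (max b c)) := by
  unfold mid
  rcases le_total b c with h | h <;> simp only [h, max_eq_left, max_eq_right, min_eq_left,
    min_eq_right] <;> grind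

theorem hasDerivAt_mul_one_sub_sq (k p : ℝ) :
    HasDerivAt (fun x : ℝ => k * (1 - x) ^ 2) (-(2 * k * (1 - p))) p := by
  have h := (((hasDerivAt_id p).const_sub 1).pow 2).const_mul k
  exact h.congr_deriv (by simp; ring)

/-- A function lying above two functions that it meets at `x` with different slopes is not
differentiable at `x`. -/
theorem not_differentiableAt_of_ge {f g h : ℝ → ℝ} {g' h' x : ℝ} (hg : HasDerivAt g g' x)
    (hh : HasDerivAt h h' x) (hne : g' ≠ h') (hgx : g x = f x) (hhx : h x = f x)
    (hgf : g ≤ᶠ[𝓝 x] f) (hhf : h ≤ᶠ[𝓝 x] f) : ¬ DifferentiableAt ℝ f x := by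
  intro hf
  have slope {u : ℝ → ℝ} {u' : ℝ} (hu : HasDerivAt u u' x) (hux : u x = f x)
      (huf : u ≤ᶠ[𝓝 x] f) : deriv f x = u' := by
    have hmin : IsLocalMin (f - u) x := by
      filter_upwards [huf] with y hy
      simpa [hux] using hy
    exact sub_eq_zero.mp (hmin.hasDerivAt_eq_zero (hf.hasDerivAt.sub hu))
  exact hne ((slope hg hgx hgf).symm.trans (slope hh hhx hhf))

/-- A function lying below two functions that it meets at `x` with different slopes is not
differentiable at `x`. -/
theorem not_differentiableAt_of_le {f g h : ℝ → ℝ} {g' h' x : ℝ} (hg : HasDerivAt g g' x)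
    (hh : HasDerivAt h h' x) (hne : g' ≠ h') (hgx : g x = f x) (hhx : h x = f x)
    (hgf : f ≤ᶠ[𝓝 x] g) (hhf : f ≤ᶠ[𝓝 x] h) : ¬ DifferentiableAt ℝ f x := by
  intro hf
  refine not_differentiableAt_of_ge (f := -f) hg.neg hh.neg (by simpa using hne)
    (by simp [hgx]) (by simp [hhx]) ?_ ?_ hf.neg
  · filter_upwards [hgf] with y hy
    simpa using hy
  · filter_upwards [hhf] with y hy
    simpa using hy

/-- The median of `a`, `m * (1 - p) ^ 2` and `M * (1 - p) ^ 2`, for `m ≤ M`. -/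
noncomputable def decayMedian (a m M p : ℝ) : ℝ :=
  max (m * (1 - p) ^ 2) (min a (M * (1 - p) ^ 2))

section decayMedian

variable {a m M p : ℝ}

theorem differentiableAt_decayMedian (hmM : m ≤ M) (hm : m * (1 - p) ^ 2 ≠ a)
    (hM : M * (1 - p) ^ 2 ≠ a) : DifferentiableAt ℝ (decayMedian a m M) p := by
  have cont (k : ℝ) := (hasDerivAt_mul_one_sub_sq k p).continuousAt
  have diff (k : ℝ) := (hasDerivAt_mul_one_sub_sq k p).differentiableAt
  have mono (x : ℝ) : m * (1 - x) ^ 2 ≤ M * (1 - x) ^ 2 := by gcongr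
  rcases hm.lt_or_gt with hm | hm
  · rcases hM.lt_or_gt with hM | hM
    · refine (diff M).congr_of_eventuallyEq ?_
      filter_upwards [(cont M).eventually_lt_const hM] with x hx
      simp [decayMedian, hx.le, mono x]
    · refine (differentiableAt_const a).congr_of_eventuallyEq ?_
      filter_upwards [(cont m).eventually_lt_const hm, (cont M).eventually_const_lt hM]
        with x hx hx'
      simp [decayMedian, hx.le, hx'.le]
  · refine (diff m).congr_of_eventuallyEq ?_
    filter_upwards [(cont m).eventually_const_lt hm] with x hx
    simp [decayMedian, hx.le]

theorem not_differentiableAt_decayMedian_of_lower (hmM : m < M) (ha : 0 < a)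
    (hp : m * (1 - p) ^ 2 = a) : ¬ DifferentiableAt ℝ (decayMedian a m M) p := by
  have hp1 : 1 - p ≠ 0 := by rintro h; simp [h] at hp; exact ha.ne hp
  have hm : m ≠ 0 := by rintro rfl; simp at hp; exact ha.ne hp
  have hlt : a < M * (1 - p) ^ 2 := by rw [← hp]; gcongr
  refine not_differentiableAt_of_ge (hasDerivAt_mul_one_sub_sq m p) (hasDerivAt_const p a)
    (by simp [hm, hp1]) ?_ ?_ (.of_forall fun x => le_max_left _ _) ?_
  · simp [decayMedian, hp]
  · simp [decayMedian, hp, hlt.le]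
  · filter_upwards [(hasDerivAt_mul_one_sub_sq M p).continuousAt.eventually_const_lt hlt]
      with x hx
    simp [decayMedian, hx.le]

theorem not_differentiableAt_decayMedian_of_upper (hmM : m < M) (ha : 0 < a)
    (hp : M * (1 - p) ^ 2 = a) : ¬ DifferentiableAt ℝ (decayMedian a m M) p := by
  have hp1 : 1 - p ≠ 0 := by rintro h; simp [h] at hp; exact ha.ne hp
  have hM : M ≠ 0 := by rintro rfl; simp at hp; exact ha.ne hp
  have hlt : m * (1 - p) ^ 2 < a := by rw [← hp]; gcongr
  refine not_differentiableAt_of_le (hasDerivAt_mul_one_sub_sq M p) (hasDerivAt_const p a)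
    (by simp [hM, hp1]) ?_ ?_ (.of_forall fun x => ?_) ?_
  · simp [decayMedian, hp, hlt.le]
  · simp [decayMedian, hp, hlt.le]
  · exact max_le (mul_le_mul_of_nonneg_right hmM.le (sq_nonneg _)) (min_le_right _ _)
  · filter_upwards [(hasDerivAt_mul_one_sub_sq m p).continuousAt.eventually_lt_const hlt]
      with x hx
    simp [decayMedian, hx.le]

theorem eq_of_mul_one_sub_sq_eq {k q : ℝ} (ha : a ≠ 0) (hp : p < 1) (hq : q < 1)
    (hpa : k * (1 - p) ^ 2 = a) (hqa : k * (1 - q) ^ 2 = a) : p = q := by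
  have hk : k ≠ 0 := by rintro rfl; simp at hpa; exact ha hpa.symm
  have h := mul_left_cancel₀ hk (hpa.trans hqa.symm)
  have := (sq_eq_sq₀ (by linarith) (by linarith)).mp h
  linarith

theorem exists_mul_one_sub_sq_eq {k : ℝ} (ha : 0 < a) (hk : a < k) :
    ∃ p ∈ Set.Ioo (0 : ℝ) 1, k * (1 - p) ^ 2 = a := by
  have hk0 : 0 < k := ha.trans hk
  refine ⟨1 - √(a / k), ⟨?_, ?_⟩, ?_⟩
  · rw [sub_pos, Real.sqrt_lt' one_pos, one_pow, div_lt_one hk0]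
    exact hk
  · have : 0 < √(a / k) := by positivity
    linarith
  · rw [sub_sub_cancel, Real.sq_sqrt (by positivity)]
    field_simp

theorem ncard_not_differentiableAt_decayMedian_eq_two_iff (ha : 0 ≤ a) (hm : 0 ≤ m)
    (hmM : m ≤ M) :
    {p ∈ Set.Ioo (0 : ℝ) 1 | ¬ DifferentiableAt ℝ (decayMedian a m M) p}.ncard = 2 ↔
      a ≠ 0 ∧ a < m ∧ m ≠ M := by
  constructor
  · intro hcard
    have smooth (h : decayMedian a m M = fun p => m * (1 - p) ^ 2) : False := by
      have hd (p : ℝ) : DifferentiableAt ℝ (decayMedian a m M) p :=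
        h ▸ (hasDerivAt_mul_one_sub_sq m p).differentiableAt
      simp [hd] at hcard
    have ha0 : a ≠ 0 := by
      rintro rfl
      refine smooth (funext fun p => max_eq_left ((min_le_left _ _).trans ?_))
      positivity
    refine ⟨ha0, ?_, ?_⟩
    · by_contra! hma
      have upper : ∀ p ∈ {p ∈ Set.Ioo (0 : ℝ) 1 | ¬ DifferentiableAt ℝ (decayMedian a m M) p},
          M * (1 - p) ^ 2 = a := by
        rintro p ⟨⟨hp0, hp1⟩, hp⟩
        by_contra hM
        refine hp (differentiableAt_decayMedian hmM (fun h => ?_) hM)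
        have ha' : 0 < a := ha.lt_of_ne' ha0
        nlinarith [mul_pos ha' hp0, mul_pos ha' (sub_pos.mpr hp1),
          mul_le_mul_of_nonneg_right hma (sq_nonneg (1 - p)),
          mul_pos (mul_pos ha' hp0) (sub_pos.mpr hp1)]
      obtain ⟨p, q, hpq, hS⟩ := Set.ncard_eq_two.mp hcard
      have hp := hS.ge (Set.mem_insert p {q})
      have hq := hS.ge (Set.mem_insert_of_mem p (Set.mem_singleton q))
      exact hpq (eq_of_mul_one_sub_sq_eq ha0 hp.1.2 hq.1.2 (upper p hp) (upper q hq))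
    · rintro rfl
      exact smooth (funext fun p => max_eq_left (min_le_right _ _))
  · rintro ⟨ha0, ham, hne⟩
    have ha' : 0 < a := ha.lt_of_ne' ha0
    have hlt : m < M := hmM.lt_of_ne hne
    obtain ⟨p, hp, hpa⟩ := exists_mul_one_sub_sq_eq ha' ham
    obtain ⟨q, hq, hqa⟩ := exists_mul_one_sub_sq_eq ha' (ham.trans hlt)
    refine Set.ncard_eq_two.mpr ⟨p, q, ?_, ?_⟩
    · rintro rfl
      have h1 : (1 - p) ^ 2 ≠ 0 := pow_ne_zero 2 (sub_ne_zero.mpr hp.2.ne')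
      exact hne (mul_right_cancel₀ h1 (hpa.trans hqa.symm))
    · ext x
      simp only [Set.mem_ofPred_eq, Set.mem_insert_iff, Set.mem_singleton_iff]
      constructor
      · rintro ⟨hx, hxd⟩
        by_contra! h
        exact hxd (differentiableAt_decayMedian hmM
          (fun h' => h.1 (eq_of_mul_one_sub_sq_eq ha0 hx.2 hp.2 h' hpa))
          (fun h' => h.2 (eq_of_mul_one_sub_sq_eq ha0 hx.2 hq.2 h' hqa)))
      · rintro (rfl | rfl)
        · exact ⟨hp, not_differentiableAt_decayMedian_of_lower hlt ha' hpa⟩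
        · exact ⟨hq, not_differentiableAt_decayMedian_of_upper hlt ha' hqa⟩

end decayMedian

/-- Necessary and sufficient conditions for a double sudden change of the 1-norm geometric
discord under the bit-flip channel. -/
theorem bitFlip_doubleSuddenChange_iff (c₁ c₂ c₃ : ℝ) (f : ℝ → ℝ)
    (hf : ∀ p, f p = mid |c₁| (|c₂| * (1 - p) ^ 2) (|c₃| * (1 - p) ^ 2)) :
    {p ∈ Set.Ioo (0 : ℝ) 1 | ¬ DifferentiableAt ℝ f p}.ncard = 2 ↔
      c₁ ≠ 0 ∧ |c₁| < |c₂| ∧ |c₁| < |c₃| ∧ |c₂| ≠ |c₃| := by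
  have hf' : f = decayMedian |c₁| (min |c₂| |c₃|) (max |c₂| |c₃|) := by
    funext p
    rw [hf, mid_eq_max_min, decayMedian, min_mul_of_nonneg _ _ (sq_nonneg _),
      max_mul_of_nonneg _ _ (sq_nonneg _)]
  rw [hf', ncard_not_differentiableAt_decayMedian_eq_two_iff (abs_nonneg _) (by positivity)
    min_le_max, lt_min_iff, abs_ne_zero, and_assoc,
    (inf_eq_sup (a := |c₂|) (b := |c₃|)).ne]
end

section
/- Let c1,c2,c3 ∈ ℝ with c1 ≠ 0, c2 ≠ 0, and c3 ≠ 0. Then the function f(γ) = mid(|c1|(1−γ), |c2|(1−γ), |c3|(1−γ)²) is strictly decreasing on [0,1]; in particular, the 1-norm geometric discord of a nontrivial Bell-diagonal state exhibits no freezing behavior under the generalized amplitude damping channel at p = 1/2 (it is not constant on any nondegenerate subinterval of [0,1]). -/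
/-- The median is strictly increasing when all three arguments strictly increase. -/
theorem mid_lt_mid {a b c a' b' c' : ℝ} (ha : a < a') (hb : b < b') (hc : c < c') :
    mid a b c < mid a' b' c' := by
  unfold mid
  grind

/-- For a nontrivial Bell-diagonal state, the 1-norm geometric discord under the generalized
amplitude damping channel at `p = 1/2` is strictly decreasing on `[0,1]`; in particular it
exhibits no freezing behavior (it is not constant on any nondegenerate subinterval). -/
theorem gad_no_freezing (c₁ c₂ c₃ : ℝ) (h₁ : c₁ ≠ 0) (h₂ : c₂ ≠ 0) (h₃ : c₃ ≠ 0)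
    (f : ℝ → ℝ)
    (hf : ∀ γ, f γ = mid (|c₁| * (1 - γ)) (|c₂| * (1 - γ)) (|c₃| * (1 - γ) ^ 2)) :
    StrictAntiOn f (Set.Icc 0 1) ∧
    ∀ a b : ℝ, a ∈ Set.Icc (0 : ℝ) 1 → b ∈ Set.Icc (0 : ℝ) 1 → a < b →
      ¬ ∀ x ∈ Set.Icc a b, f x = f a := by
  have hanti : StrictAntiOn f (Set.Icc 0 1) := by
    intro x _ y hy hxy
    rw [hf, hf]
    have hy1 : 0 ≤ 1 - y := sub_nonneg.mpr hy.2
    have hlt : 1 - y < 1 - x := by linarith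
    exact mid_lt_mid (mul_lt_mul_of_pos_left hlt (abs_pos.mpr h₁))
      (mul_lt_mul_of_pos_left hlt (abs_pos.mpr h₂))
      (mul_lt_mul_of_pos_left (pow_lt_pow_left₀ hlt hy1 two_ne_zero) (abs_pos.mpr h₃))
  refine ⟨hanti, fun a b ha hb hab hconst => ?_⟩
  exact (hanti ha hb hab).ne (hconst b ⟨hab.le, le_rfl⟩)
end

section
/- (Proposition, phase-flip case) Let c1,c2,c3 ∈ ℝ and define the 2-norm geometric discord under the phase-flip channel as D2(p) = (1/4)·[c1²(1−p)⁴ + c2²(1−p)⁴ + c3² − max(c1²(1−p)⁴, c2²(1−p)⁴, c3²)] for p ∈ [0,1]. Then (a) the set {p ∈ (0,1) : D2 is not differentiable at p} has at most one element (no double sudden change), and (b) if c1 ≠ 0, c2 ≠ 0, and c3 ≠ 0, then D2 is strictly decreasing on [0,1]; in particular D2 is not constant on any nondegenerate subinterval of [0,1] (no nonvanishing freezing). -/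
lemma add_add_sub_max_eq_mul_min_add_min (a b c : ℝ) {q : ℝ} (hq : 0 ≤ q) :
    a * q + b * q + c - max (a * q) (max (b * q) c) = min a b * q + min (max a b * q) c := by
  rw [← max_assoc, ← max_mul_of_nonneg a b hq]
  linear_combination q * (min_add_max a b).symm - min_add_max (max a b * q) c

lemma strictAntiOn_one_sub_pow_four : StrictAntiOn (fun p : ℝ => (1 - p) ^ 4) (Set.Icc 0 1) :=
  fun _ _ _ hy hxy => pow_lt_pow_left₀ (by linarith) (by linarith [hy.2]) (by norm_num)

/-- A combination of a differentiable function and its truncation `min (M * f) c` can only fail to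
be differentiable where the two branches of the minimum meet, and only if `M ≠ 0`. -/
lemma eq_of_not_differentiableAt_add_min_mul {f : ℝ → ℝ} {m M c p : ℝ}
    (hf : Differentiable ℝ f) (hc : 0 ≤ c)
    (h : ¬ DifferentiableAt ℝ (fun x => m * f x + min (M * f x) c) p) :
    M ≠ 0 ∧ M * f p = c := by
  refine ⟨?_, ?_⟩
  · rintro rfl
    exact h (by simpa [hc] using (hf p).const_mul m)
  · by_contra hne
    have hcont : Continuous fun x => M * f x := continuous_const.mul hf.continuous
    rcases lt_or_gt_of_ne hne with hlt | hgt
    · refine h ((((hf p).const_mul m).add ((hf p).const_mul M)).congr_of_eventuallyEq ?_)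
      filter_upwards [hcont.continuousAt.eventually_lt continuousAt_const hlt] with x hx
      simp [min_eq_left hx.le]
    · refine h ((((hf p).const_mul m).add_const c).congr_of_eventuallyEq ?_)
      filter_upwards [continuousAt_const.eventually_lt hcont.continuousAt hgt] with x hx
      simp [min_eq_right hx.le]

/-- The 2-norm (Hilbert–Schmidt) geometric discord of a Bell-diagonal state evolving under
the phase-flip channel has at most one sudden change and, for nontrivial states, no
nonvanishing freezing behavior. -/
theorem twoNorm_phaseFlip_no_double_no_freezing (c₁ c₂ c₃ : ℝ) (D₂ : ℝ → ℝ)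
    (hD : ∀ p, D₂ p = (1 / 4) * (c₁ ^ 2 * (1 - p) ^ 4 + c₂ ^ 2 * (1 - p) ^ 4 + c₃ ^ 2
      - max (c₁ ^ 2 * (1 - p) ^ 4) (max (c₂ ^ 2 * (1 - p) ^ 4) (c₃ ^ 2)))) :
    {p ∈ Set.Ioo (0 : ℝ) 1 | ¬ DifferentiableAt ℝ D₂ p}.ncard ≤ 1 ∧
    (c₁ ≠ 0 → c₂ ≠ 0 → c₃ ≠ 0 →
      StrictAntiOn D₂ (Set.Icc 0 1) ∧
      ∀ a b : ℝ, a ∈ Set.Icc (0 : ℝ) 1 → b ∈ Set.Icc (0 : ℝ) 1 → a < b →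
        ¬ ∀ x ∈ Set.Icc a b, D₂ x = D₂ a) := by
  have hD' : D₂ = fun p => (1 / 4) * (min (c₁ ^ 2) (c₂ ^ 2) * (1 - p) ^ 4 +
      min (max (c₁ ^ 2) (c₂ ^ 2) * (1 - p) ^ 4) (c₃ ^ 2)) := by
    funext p
    rw [hD, add_add_sub_max_eq_mul_min_add_min _ _ _ (by positivity)]
  refine ⟨?_, fun h₁ h₂ _ => ?_⟩
  · have hsub : {p ∈ Set.Ioo (0 : ℝ) 1 | ¬ DifferentiableAt ℝ D₂ p}.Subsingleton := by
      have key : ∀ p, ¬ DifferentiableAt ℝ D₂ p → max (c₁ ^ 2) (c₂ ^ 2) ≠ 0 ∧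
          max (c₁ ^ 2) (c₂ ^ 2) * (1 - p) ^ 4 = c₃ ^ 2 := fun p hp =>
        eq_of_not_differentiableAt_add_min_mul (f := fun x => (1 - x) ^ 4)
          (m := min (c₁ ^ 2) (c₂ ^ 2)) (by fun_prop) (sq_nonneg c₃)
          fun h => hp (hD' ▸ h.const_mul (1 / 4))
      rintro x ⟨hx, hdx⟩ y ⟨hy, hdy⟩
      obtain ⟨hM, hxc⟩ := key x hdx
      exact strictAntiOn_one_sub_pow_four.injOn (Set.Ioo_subset_Icc_self hx)
        (Set.Ioo_subset_Icc_self hy) (mul_left_cancel₀ hM (hxc.trans (key y hdy).2.symm))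
    exact (Set.ncard_le_one hsub.finite).2 fun _ hx _ hy => hsub hx hy
  · have hanti : StrictAntiOn D₂ (Set.Icc 0 1) := by
      intro x hx y hy hxy
      have hq : (1 - y) ^ 4 < (1 - x) ^ 4 := strictAntiOn_one_sub_pow_four hx hy hxy
      have hm : 0 < min (c₁ ^ 2) (c₂ ^ 2) := lt_min (by positivity) (by positivity)
      have hM : 0 ≤ max (c₁ ^ 2) (c₂ ^ 2) := le_max_of_le_left (sq_nonneg c₁)
      have hmin : min (max (c₁ ^ 2) (c₂ ^ 2) * (1 - y) ^ 4) (c₃ ^ 2) ≤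
          min (max (c₁ ^ 2) (c₂ ^ 2) * (1 - x) ^ 4) (c₃ ^ 2) :=
        min_le_min_right _ (mul_le_mul_of_nonneg_left hq.le hM)
      rw [hD']
      linarith [mul_lt_mul_of_pos_left hq hm]
    exact ⟨hanti, fun a b ha hb hab hconst =>
      (hanti ha hb hab).ne (hconst b (Set.right_mem_Icc.2 hab.le))⟩
end

section
/- (Proposition, bit-phase-flip case) Let c1,c2,c3 ∈ ℝ and define the 2-norm geometric discord under the bit-phase-flip channel as D2(p) = (1/4)·[c1²(1−p)⁴ + c2² + c3²(1−p)⁴ − max(c1²(1−p)⁴, c2², c3²(1−p)⁴)] for p ∈ [0,1]. Then (a) the set {p ∈ (0,1) : D2 is not differentiable at p} has at most one element (no double sudden change), and (b) if c1 ≠ 0, c2 ≠ 0, and c3 ≠ 0, then D2 is strictly decreasing on [0,1]; in particular D2 is not constant on any nondegenerate subinterval of [0,1] (no nonvanishing freezing). -/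
/-- If `f` and `g` are differentiable at `x` and `f x ≠ g x`, then so is their minimum. -/
theorem DifferentiableAt.min_of_ne {f g : ℝ → ℝ} {x : ℝ} (hf : DifferentiableAt ℝ f x)
    (hg : DifferentiableAt ℝ g x) (h : f x ≠ g x) :
    DifferentiableAt ℝ (fun y => min (f y) (g y)) x := by
  rcases lt_or_gt_of_ne h with h | h
  · refine hf.congr_of_eventuallyEq ?_
    filter_upwards [hf.continuousAt.eventually_lt hg.continuousAt h] with y hy
    exact min_eq_left hy.le
  · refine hg.congr_of_eventuallyEq ?_
    filter_upwards [hg.continuousAt.eventually_lt hf.continuousAt h] with y hy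
    exact min_eq_right hy.le

theorem add_add_sub_max_max (x b z : ℝ) :
    x + b + z - max x (max b z) = min x z + min (max x z) b := by
  rw [max_left_comm, max_comm b]
  linarith [min_add_max x z, min_add_max (max x z) b]

/-- The discord of a Bell-diagonal state in terms of the smaller and larger of the two
damped squared correlations. -/
theorem discord_eq_min_add_min (a b c p : ℝ) :
    a ^ 2 * (1 - p) ^ 4 + b + c ^ 2 * (1 - p) ^ 4
      - max (a ^ 2 * (1 - p) ^ 4) (max b (c ^ 2 * (1 - p) ^ 4)) =
    min (a ^ 2) (c ^ 2) * (1 - p) ^ 4 + min (max (a ^ 2) (c ^ 2) * (1 - p) ^ 4) b := by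
  have ht : 0 ≤ (1 - p) ^ 4 := by positivity
  rw [add_add_sub_max_max, min_mul_of_nonneg _ _ ht, max_mul_of_nonneg _ _ ht]

theorem subsingleton_not_differentiableAt_damped (m M b : ℝ) :
    {p ∈ Set.Ioo (0 : ℝ) 1 | ¬ DifferentiableAt ℝ
      (fun p => (1 / 4) * (m * (1 - p) ^ 4 + min (M * (1 - p) ^ 4) b)) p}.Subsingleton := by
  rcases eq_or_ne M 0 with rfl | hM
  · rintro p ⟨-, hp⟩
    refine absurd ?_ hp
    simp only [zero_mul]
    fun_prop
  have key : ∀ p, ¬ DifferentiableAt ℝ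
      (fun p => (1 / 4) * (m * (1 - p) ^ 4 + min (M * (1 - p) ^ 4) b)) p →
      M * (1 - p) ^ 4 = b := by
    intro p hp
    by_contra hne
    have hmin : DifferentiableAt ℝ (fun p : ℝ => min (M * (1 - p) ^ 4) b) p :=
      DifferentiableAt.min_of_ne (f := fun p => M * (1 - p) ^ 4) (g := fun _ => b)
        (by fun_prop) (by fun_prop) hne
    exact hp (by fun_prop)
  rintro p ⟨hp, hp'⟩ q ⟨hq, hq'⟩
  have h : (1 - p) ^ 4 = (1 - q) ^ 4 :=
    mul_left_cancel₀ hM ((key p hp').trans (key q hq').symm)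
  have := (pow_left_inj₀ (sub_nonneg.2 hp.2.le) (sub_nonneg.2 hq.2.le) four_ne_zero).1 h
  linarith

theorem strictAntiOn_damped {m M : ℝ} (hm : 0 < m) (hM : 0 ≤ M) (b : ℝ) :
    StrictAntiOn (fun p : ℝ => (1 / 4) * (m * (1 - p) ^ 4 + min (M * (1 - p) ^ 4) b))
      (Set.Icc 0 1) := by
  intro p _ q hq hpq
  have ht : (1 - q) ^ 4 < (1 - p) ^ 4 :=
    pow_lt_pow_left₀ (by linarith) (sub_nonneg.2 hq.2) four_ne_zero
  have h₁ : m * (1 - q) ^ 4 < m * (1 - p) ^ 4 := mul_lt_mul_of_pos_left ht hm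
  have h₂ : min (M * (1 - q) ^ 4) b ≤ min (M * (1 - p) ^ 4) b :=
    min_le_min_right b (mul_le_mul_of_nonneg_left ht.le hM)
  dsimp only
  linarith

/-- The 2-norm (Hilbert–Schmidt) geometric discord of a Bell-diagonal state evolving under
the bit-phase-flip channel has at most one sudden change and, for nontrivial states, no
nonvanishing freezing behavior. -/
theorem twoNorm_bitPhaseFlip_no_double_no_freezing (c₁ c₂ c₃ : ℝ) (D₂ : ℝ → ℝ)
    (hD : ∀ p, D₂ p = (1 / 4) * (c₁ ^ 2 * (1 - p) ^ 4 + c₂ ^ 2 + c₃ ^ 2 * (1 - p) ^ 4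
      - max (c₁ ^ 2 * (1 - p) ^ 4) (max (c₂ ^ 2) (c₃ ^ 2 * (1 - p) ^ 4)))) :
    {p ∈ Set.Ioo (0 : ℝ) 1 | ¬ DifferentiableAt ℝ D₂ p}.ncard ≤ 1 ∧
    (c₁ ≠ 0 → c₂ ≠ 0 → c₃ ≠ 0 →
      StrictAntiOn D₂ (Set.Icc 0 1) ∧
      ∀ a b : ℝ, a ∈ Set.Icc (0 : ℝ) 1 → b ∈ Set.Icc (0 : ℝ) 1 → a < b →
        ¬ ∀ x ∈ Set.Icc a b, D₂ x = D₂ a) := by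
  obtain rfl : D₂ = fun p => (1 / 4) * (min (c₁ ^ 2) (c₃ ^ 2) * (1 - p) ^ 4
      + min (max (c₁ ^ 2) (c₃ ^ 2) * (1 - p) ^ 4) (c₂ ^ 2)) :=
    funext fun p => by rw [hD, discord_eq_min_add_min]
  refine ⟨?_, fun h₁ _ h₃ => ?_⟩
  · have hs := subsingleton_not_differentiableAt_damped (min (c₁ ^ 2) (c₃ ^ 2))
      (max (c₁ ^ 2) (c₃ ^ 2)) (c₂ ^ 2)
    exact (Set.ncard_le_one hs.finite).2 fun p hp q hq => hs hp hq
  have hanti := strictAntiOn_damped (m := min (c₁ ^ 2) (c₃ ^ 2)) (M := max (c₁ ^ 2) (c₃ ^ 2))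
    (lt_min (by positivity) (by positivity)) (by positivity) (c₂ ^ 2)
  exact ⟨hanti, fun a b ha hb hab hconst =>
    (hanti ha hb hab).ne (hconst b (Set.right_mem_Icc.2 hab.le))⟩
end

section
/- (Proposition, generalized amplitude damping case) Let c1,c2,c3 ∈ ℝ and define the 2-norm geometric discord under the generalized amplitude damping channel at p = 1/2 as D2(γ) = (1/4)·[c1²(1−γ)² + c2²(1−γ)² + c3²(1−γ)⁴ − max(c1²(1−γ)², c2²(1−γ)², c3²(1−γ)⁴)] for γ ∈ [0,1]. Then (a) the set {γ ∈ (0,1) : D2 is not differentiable at γ} has at most one element (no double sudden change), and (b) if c1 ≠ 0, c2 ≠ 0, and c3 ≠ 0, then D2 is strictly decreasing on [0,1]; in particular D2 is not constant on any nondegenerate subinterval of [0,1] (no nonvanishing freezing). -/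
/-- Removing the largest of three terms from a sum leaves the smaller of the first two plus the
smaller of the third and the larger of the first two, here with the first two terms scaled by a
common nonnegative factor. -/
lemma sum_sub_max_eq (a b t w : ℝ) (ht : 0 ≤ t) :
    a * t + b * t + w - max (a * t) (max (b * t) w)
      = min a b * t + min (max a b * t) w := by
  rw [← max_assoc, ← max_mul_of_nonneg a b ht]
  linear_combination t * (min_add_max a b).symm + (min_add_max (max a b * t) w).symm

lemma differentiableAt_min_of_ne {f g : ℝ → ℝ} {x : ℝ} (hf : DifferentiableAt ℝ f x)
    (hg : DifferentiableAt ℝ g x) (h : f x ≠ g x) :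
    DifferentiableAt ℝ (fun y ↦ min (f y) (g y)) x := by
  rcases lt_or_gt_of_ne h with h | h
  · refine hf.congr_of_eventuallyEq ?_
    filter_upwards [hf.continuousAt.eventually_lt hg.continuousAt h] with y hy
    exact min_eq_left hy.le
  · refine hg.congr_of_eventuallyEq ?_
    filter_upwards [hg.continuousAt.eventually_lt hf.continuousAt h] with y hy
    exact min_eq_right hy.le

/-- The 2-norm (Hilbert–Schmidt) geometric discord of a Bell-diagonal state evolving under
the generalized amplitude damping channel at `p = 1/2` has at most one sudden change and,
for nontrivial states, no nonvanishing freezing behavior. -/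
theorem twoNorm_gad_no_double_no_freezing (c₁ c₂ c₃ : ℝ) (D₂ : ℝ → ℝ)
    (hD : ∀ γ, D₂ γ = (1 / 4) * (c₁ ^ 2 * (1 - γ) ^ 2 + c₂ ^ 2 * (1 - γ) ^ 2
      + c₃ ^ 2 * (1 - γ) ^ 4
      - max (c₁ ^ 2 * (1 - γ) ^ 2) (max (c₂ ^ 2 * (1 - γ) ^ 2) (c₃ ^ 2 * (1 - γ) ^ 4)))) :
    {γ ∈ Set.Ioo (0 : ℝ) 1 | ¬ DifferentiableAt ℝ D₂ γ}.ncard ≤ 1 ∧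
    (c₁ ≠ 0 → c₂ ≠ 0 → c₃ ≠ 0 →
      StrictAntiOn D₂ (Set.Icc 0 1) ∧
      ∀ a b : ℝ, a ∈ Set.Icc (0 : ℝ) 1 → b ∈ Set.Icc (0 : ℝ) 1 → a < b →
        ¬ ∀ x ∈ Set.Icc a b, D₂ x = D₂ a) := by
  have hD' : D₂ = fun γ ↦ (1 / 4) * (min (c₁ ^ 2) (c₂ ^ 2) * (1 - γ) ^ 2
      + min (max (c₁ ^ 2) (c₂ ^ 2) * (1 - γ) ^ 2) (c₃ ^ 2 * (1 - γ) ^ 4)) := by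
    funext γ
    rw [hD, sum_sub_max_eq _ _ _ _ (sq_nonneg _)]
  have hM : 0 ≤ max (c₁ ^ 2) (c₂ ^ 2) := le_max_of_le_left (sq_nonneg _)
  constructor
  · have crossing : ∀ γ, ¬ DifferentiableAt ℝ D₂ γ →
        max (c₁ ^ 2) (c₂ ^ 2) * (1 - γ) ^ 2 = c₃ ^ 2 * (1 - γ) ^ 4 := by
      intro γ hγ
      by_contra hne
      apply hγ
      rw [hD']
      have h := differentiableAt_min_of_ne
        (f := fun y ↦ max (c₁ ^ 2) (c₂ ^ 2) * (1 - y) ^ 2)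
        (g := fun y ↦ c₃ ^ 2 * (1 - y) ^ 4) (x := γ) (by fun_prop) (by fun_prop) hne
      fun_prop
    have hc₃ : ∀ γ, ¬ DifferentiableAt ℝ D₂ γ → c₃ ≠ 0 := by
      rintro γ hγ rfl
      apply hγ
      have hmin : ∀ y : ℝ, min (max (c₁ ^ 2) (c₂ ^ 2) * (1 - y) ^ 2) 0 = 0 :=
        fun y ↦ min_eq_right (mul_nonneg hM (sq_nonneg _))
      simp only [hD', ne_eq, OfNat.ofNat_ne_zero, not_false_eq_true, zero_pow, zero_mul, hmin]
      fun_prop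
    have hsub : {γ ∈ Set.Ioo (0 : ℝ) 1 | ¬ DifferentiableAt ℝ D₂ γ}.Subsingleton := by
      rintro x ⟨⟨-, hx⟩, hdx⟩ y ⟨⟨-, hy⟩, hdy⟩
      have level : ∀ z < 1, ¬ DifferentiableAt ℝ D₂ z →
          max (c₁ ^ 2) (c₂ ^ 2) = c₃ ^ 2 * (1 - z) ^ 2 := by
        intro z hz hdz
        have hz' : (1 - z) ^ 2 ≠ 0 := pow_ne_zero _ (sub_ne_zero.2 hz.ne')
        apply mul_right_cancel₀ hz'
        linear_combination crossing z hdz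
      have hsq : (1 - x) ^ 2 = (1 - y) ^ 2 :=
        mul_left_cancel₀ (pow_ne_zero 2 (hc₃ x hdx))
          ((level x hx hdx).symm.trans (level y hy hdy))
      have := (pow_left_inj₀ (sub_nonneg.2 hx.le) (sub_nonneg.2 hy.le) two_ne_zero).1 hsq
      linarith
    rw [Set.ncard_le_one hsub.finite]
    exact fun a ha b hb ↦ hsub ha hb
  · intro h₁ h₂ _
    have anti : StrictAntiOn D₂ (Set.Icc 0 1) := by
      rintro x ⟨-, hx⟩ y ⟨-, hy⟩ hxy
      have hm : 0 < min (c₁ ^ 2) (c₂ ^ 2) := lt_min (by positivity) (by positivity)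
      have hy' : 0 ≤ 1 - y := sub_nonneg.2 hy
      have hlt : 1 - y < 1 - x := by linarith
      rw [hD']
      dsimp only
      refine mul_lt_mul_of_pos_left (add_lt_add_of_lt_of_le ?_ ?_) (by norm_num)
      · gcongr
      · gcongr
    refine ⟨anti, fun a b ha hb hab h ↦ ?_⟩
    exact (anti ha hb hab).ne (h b (Set.right_mem_Icc.2 hab.le))
end

section
/- Let c ∈ ℝ with 0 < |c| < 1, and consider the Bell-diagonal state with correlation vector (1, −c, c) under the phase-flip channel, whose 1-norm geometric discord is f(p) = mid((1−p)², |c|(1−p)², |c|) for p ∈ [0,1]. Then f(p) = min(|c|, (1−p)²) for all p ∈ [0,1]; in particular f is frozen at the constant value |c| on the interval [0, 1−√|c|], equals (1−p)² on [1−√|c|, 1], and has exactly one point of non-differentiability in (0,1), namely the sudden change point p^SC = 1 − √|c|. -/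
theorem mid_mul_eq_min {a x : ℝ} (ha : 0 ≤ a) (ha1 : a ≤ 1) (hx : 0 ≤ x) (hx1 : x ≤ 1) :
    mid x (a * x) a = min a x := by
  have hax : a * x ≤ x := mul_le_of_le_one_left hx ha1
  have hxa : a * x ≤ a := mul_le_of_le_one_right ha hx1
  rw [mid, max_eq_right hxa, min_eq_left hxa, min_eq_right hax]
  linarith [min_add_max a x, max_comm a x]

theorem hasDerivAt_one_sub_sq (p : ℝ) :
    HasDerivAt (fun x : ℝ => (1 - x) ^ 2) (-2 * (1 - p)) p :=
  (((hasDerivAt_id p).const_sub 1).pow 2).congr_deriv (by simp)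

/-- A function equal to a constant on the left of `q` and to `(1 - p) ^ 2` on the right has a
kink at `q`. -/
theorem not_differentiableAt_of_eqOn_const_of_eqOn_sq {f : ℝ → ℝ} {a l q r : ℝ}
    (hl : l < q) (hr : q < r) (hq : q ≠ 1) (hleft : ∀ p ∈ Set.Icc l q, f p = a)
    (hright : ∀ p ∈ Set.Icc q r, f p = (1 - p) ^ 2) : ¬ DifferentiableAt ℝ f q := by
  intro h
  have hql : q ∈ Set.Icc l q := Set.right_mem_Icc.2 hl.le
  have hqr : q ∈ Set.Icc q r := Set.left_mem_Icc.2 hr.le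
  have h₁ : HasDerivWithinAt f 0 (Set.Icc l q) q :=
    (hasDerivWithinAt_const q _ a).congr hleft (hleft q hql)
  have h₂ : HasDerivWithinAt f (-2 * (1 - q)) (Set.Icc q r) q :=
    (hasDerivAt_one_sub_sq q).hasDerivWithinAt.congr hright (hright q hqr)
  have e₁ := (uniqueDiffOn_Icc hl q hql).eq_deriv _ h.hasDerivAt.hasDerivWithinAt h₁
  have e₂ := (uniqueDiffOn_Icc hr q hqr).eq_deriv _ h.hasDerivAt.hasDerivWithinAt h₂
  exact hq (by linarith)

/-- Freezing followed by a single sudden change at `p = 1 − √|c|` for the Bell-diagonal state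
with correlation vector `(1, −c, c)` under the phase-flip channel. -/
theorem phaseFlip_freezing_singleSuddenChange (c : ℝ) (hc0 : 0 < |c|) (hc1 : |c| < 1)
    (f : ℝ → ℝ) (hf : ∀ p, f p = mid ((1 - p) ^ 2) (|c| * (1 - p) ^ 2) |c|) :
    (∀ p ∈ Set.Icc (0 : ℝ) 1, f p = min |c| ((1 - p) ^ 2)) ∧
    (∀ p ∈ Set.Icc (0 : ℝ) (1 - Real.sqrt |c|), f p = |c|) ∧
    (∀ p ∈ Set.Icc (1 - Real.sqrt |c|) (1 : ℝ), f p = (1 - p) ^ 2) ∧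
    {p ∈ Set.Ioo (0 : ℝ) 1 | ¬ DifferentiableAt ℝ f p} = {1 - Real.sqrt |c|} := by
  have hs0 : 0 < Real.sqrt |c| := Real.sqrt_pos.2 hc0
  have hss : Real.sqrt |c| ^ 2 = |c| := Real.sq_sqrt hc0.le
  have hs1 : Real.sqrt |c| < 1 := by nlinarith
  have hmin : ∀ p ∈ Set.Icc (0 : ℝ) 1, f p = min |c| ((1 - p) ^ 2) := by
    rintro p ⟨hp0, hp1⟩
    rw [hf]
    exact mid_mul_eq_min hc0.le hc1.le (sq_nonneg _) (by nlinarith)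
  have hleft : ∀ p ∈ Set.Icc (0 : ℝ) (1 - Real.sqrt |c|), f p = |c| := by
    rintro p ⟨hp0, hp1⟩
    rw [hmin p ⟨hp0, by linarith⟩]
    exact min_eq_left (by nlinarith)
  have hright : ∀ p ∈ Set.Icc (1 - Real.sqrt |c|) (1 : ℝ), f p = (1 - p) ^ 2 := by
    rintro p ⟨hp0, hp1⟩
    rw [hmin p ⟨by linarith, hp1⟩]
    exact min_eq_right (by nlinarith)
  refine ⟨hmin, hleft, hright, Set.Subset.antisymm ?_ ?_⟩
  · rintro p ⟨⟨hp0, hp1⟩, hnd⟩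
    by_contra hne
    apply hnd
    rcases lt_or_gt_of_ne hne with h | h
    · exact (differentiableAt_const |c|).congr_of_eventuallyEq
        (Filter.eventually_of_mem (Icc_mem_nhds hp0 h) hleft)
    · exact (hasDerivAt_one_sub_sq p).differentiableAt.congr_of_eventuallyEq
        (Filter.eventually_of_mem (Icc_mem_nhds h hp1) hright)
  · rintro p rfl
    exact ⟨⟨by linarith, by linarith⟩, not_differentiableAt_of_eqOn_const_of_eqOn_sq
      (by linarith) (by linarith) (by linarith) hleft hright⟩
end
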